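/- arXiv:2010.06316 — 6 statements merged into one kernel-verified Lean document; each statement's English description precedes it below -/
import Mathlib

section
/- Let E be a real normed vector space, let l be a real number, and let φ : E → ℝ satisfy the l-uniform convexity inequality φ(tα + (1−t)β) ≤ t·φ(α) + (1−t)·φ(β) − l·t·(1−t)·φ(β − α) for all α, β ∈ E and all t ∈ [0,1]. If φ is Fréchet differentiable at a point β ∈ E with derivative Dφ(β), then for every α ∈ E one has φ(β − α) ≥ φ(β) − Dφ(β)(α) + l·φ(−α). -/
theorem strong_convexity_proof2
    {E : Type*} [NormedAddCommGroup E] [NormedSpace ℝ E]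
    (φ : E → ℝ) (l : ℝ)
    (hconv : ∀ α β : E, ∀ t : ℝ, t ∈ Set.Icc (0 : ℝ) 1 →
      φ (t • α + (1 - t) • β) ≤ t * φ α + (1 - t) * φ β - l * t * (1 - t) * φ (β - α))
    (β : E) (Dφβ : E →L[ℝ] ℝ) (hdiff : HasFDerivAt φ Dφβ β) :
    ∀ α : E, φ (β - α) ≥ φ β - Dφβ α + l * φ (-α) := by
  intro α
  have hslope := (hdiff.hasLineDerivAt (-α)).tendsto_slope_zero_right
  have hbound : Filter.Tendsto (fun s : ℝ => φ (β - α) - φ β - l * (1 - s) * φ (-α))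
      (nhdsWithin 0 (Set.Ioi 0)) (nhds (φ (β - α) - φ β - l * (1 - 0) * φ (-α))) :=
    (Continuous.tendsto (by fun_prop) 0).mono_left nhdsWithin_le_nhds
  have hle := le_of_tendsto_of_tendsto hslope hbound (by
    filter_upwards [Ioo_mem_nhdsGT (zero_lt_one' ℝ)] with s hs
    have h := hconv β (β - α) (1 - s) ⟨by linarith [hs.2], by linarith [hs.1]⟩
    rw [show (1 - s) • β + (1 - (1 - s)) • (β - α) = β + s • -α by module,
      show β - α - β = -α by abel] at h
    rw [smul_eq_mul, inv_mul_le_iff₀ hs.1]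
    linarith)
  rw [map_neg] at hle
  linarith
end

section
/- Let E be a real normed vector space, let l ∈ (0,1] and r ≥ 1 be real numbers, and let φ : E → ℝ be nonnegative, positively 2-homogeneous (φ(c·α) = c²·φ(α) for c > 0), Fréchet differentiable on E, satisfying the l-uniform convexity inequality φ(tα + (1−t)β) ≤ t·φ(α) + (1−t)·φ(β) − l·t·(1−t)·φ(β − α) for all α, β ∈ E and t ∈ [0,1], and satisfying the reversibility bound φ(−γ) ≥ φ(γ)/r² for all γ ∈ E. Then for all α, β ∈ E one has φ(α + β) ≤ (2 − l²/r²)·φ(α) + (2 − l)·φ(β) + l·Dφ(β)(α), where Dφ(β) is the Fréchet derivative of φ at β. -/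
/-- First-order lower bound for a uniformly convex function at a point of differentiability. -/
theorem fderiv_le_sub_of_uniform_convexity
    {E : Type*} [NormedAddCommGroup E] [NormedSpace ℝ E]
    {φ : E → ℝ} {l : ℝ} {β : E} {D : E →L[ℝ] ℝ} (hD : HasFDerivAt φ D β) (v : E)
    (hconv : ∀ t : ℝ, t ∈ Set.Icc (0 : ℝ) 1 →
      φ (t • (β + v) + (1 - t) • β) ≤
        t * φ (β + v) + (1 - t) * φ β - l * t * (1 - t) * φ (-v)) :
    D v ≤ φ (β + v) - φ β - l * φ (-v) := by
  have hlim := (hD.hasLineDerivAt v).tendsto_slope_zero_right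
  have hbound : Filter.Tendsto (fun t : ℝ => φ (β + v) - φ β - l * (1 - t) * φ (-v))
      (nhdsWithin 0 (Set.Ioi 0)) (nhds (φ (β + v) - φ β - l * φ (-v))) := by
    have hc : Continuous fun t : ℝ => φ (β + v) - φ β - l * (1 - t) * φ (-v) := by fun_prop
    simpa using (hc.tendsto 0).mono_left nhdsWithin_le_nhds
  refine le_of_tendsto_of_tendsto hlim hbound ?_
  filter_upwards [Ioo_mem_nhdsGT (zero_lt_one' ℝ)] with t ht
  have h := hconv t ⟨ht.1.le, ht.2.le⟩
  have hpt : t • (β + v) + (1 - t) • β = β + t • v := by module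
  rw [hpt] at h
  rw [smul_eq_mul]
  rw [inv_mul_le_iff₀ ht.1]
  linarith

theorem key_pointwise_inequality
    {E : Type*} [NormedAddCommGroup E] [NormedSpace ℝ E]
    (φ : E → ℝ) (l r : ℝ) (hl : l ∈ Set.Ioc (0 : ℝ) 1) (hr : 1 ≤ r)
    (hnonneg : ∀ α : E, 0 ≤ φ α)
    (hhom : ∀ c : ℝ, 0 < c → ∀ α : E, φ (c • α) = c ^ 2 * φ α)
    (Dφ : E → (E →L[ℝ] ℝ)) (hdiff : ∀ β : E, HasFDerivAt φ (Dφ β) β)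
    (hconv : ∀ α β : E, ∀ t : ℝ, t ∈ Set.Icc (0 : ℝ) 1 →
      φ (t • α + (1 - t) • β) ≤ t * φ α + (1 - t) * φ β - l * t * (1 - t) * φ (β - α))
    (hrev : ∀ γ : E, φ (-γ) ≥ φ γ / r ^ 2) :
    ∀ α β : E, φ (α + β) ≤ (2 - l ^ 2 / r ^ 2) * φ α + (2 - l) * φ β + l * Dφ β α := by
  intro α β
  have hmid := hconv α β (1 / 2) (by norm_num)
  have hhalf : φ ((1 / 2 : ℝ) • α + (1 - 1 / 2 : ℝ) • β) = (1 / 2) ^ 2 * φ (α + β) := by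
    rw [← hhom (1 / 2) (by norm_num)]
    congr 1
    module
  rw [hhalf] at hmid
  have htan := fderiv_le_sub_of_uniform_convexity (l := l) (hdiff β) (-α) (fun t ht => by
    simpa using hconv (β + -α) β t ht)
  rw [map_neg, neg_neg, ← sub_eq_add_neg] at htan
  have hscale : l ^ 2 / r ^ 2 * φ α ≤ l ^ 2 * φ α :=
    mul_le_mul_of_nonneg_right (div_le_self (sq_nonneg l) (one_le_pow₀ hr)) (hnonneg α)
  have hmul := mul_le_mul_of_nonneg_left htan hl.1.le
  linarith
end

section
/- Let n ≥ 3, let a ∈ ℝⁿ, and let u : ℝⁿ → ℝ be smooth with compact support. Then ∫_{ℝⁿ} ⟨∇(u²)(x), (x − a)/‖x − a‖²⟩ dx = −(n − 2) ∫_{ℝⁿ} u²(x)/‖x − a‖² dx, both integrals being finite (with respect to Lebesgue measure). -/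
open MeasureTheory Filter Topology

/-- The function `x ↦ ‖x - a‖⁻²` is locally integrable in dimension at least three. -/
lemma locallyIntegrable_inv_norm_sub_sq {E : Type*} [NormedAddCommGroup E] [NormedSpace ℝ E]
    [FiniteDimensional ℝ E] [MeasurableSpace E] [BorelSpace E] (μ : Measure E) [μ.IsAddHaarMeasure]
    (hE : 3 ≤ Module.finrank ℝ E) (a : E) :
    LocallyIntegrable (fun x => (‖x - a‖ ^ 2)⁻¹) μ := by
  have : Nontrivial E := Module.nontrivial_of_finrank_pos (R := ℝ) (by omega)
  have hball (r : ℝ) : IntegrableOn (fun x : E => (‖x‖ ^ 2)⁻¹) (Metric.ball 0 r) μ := by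
    rw [integrableOn_fun_norm_addHaar μ (f := fun t : ℝ => (t ^ 2)⁻¹)]
    have hpow : IntegrableOn (fun y : ℝ => y ^ (Module.finrank ℝ E - 3)) (Set.Ioo 0 r) :=
      ((continuous_pow _).integrableOn_Icc (a := 0) (b := r)).mono_set Set.Ioo_subset_Icc_self
    refine hpow.congr_fun (fun y hy => ?_) measurableSet_Ioo
    have hy0 : y ≠ 0 := hy.1.ne'
    have hdim : Module.finrank ℝ E - 1 = Module.finrank ℝ E - 3 + 2 := by omega
    simp only [hdim, pow_add, smul_eq_mul]
    field_simp
  have hloc : LocallyIntegrable (fun x : E => (‖x‖ ^ 2)⁻¹) μ := fun x =>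
    ⟨Metric.ball 0 (‖x‖ + 1), Metric.isOpen_ball.mem_nhds (by simp), hball _⟩
  intro x
  obtain ⟨s, hs, hint⟩ := hloc (x - a)
  refine ⟨(fun y => y - a) ⁻¹' s,
    (continuous_id.sub continuous_const).continuousAt.preimage_mem_nhds hs, ?_⟩
  exact ((measurePreserving_sub_right μ a).integrableOn_comp_preimage
    (MeasurableEquiv.subRight a).measurableEmbedding).2 hint

/-- The divergence theorem for a compactly supported function and a differentiable vector field. -/
lemma integral_fderiv_apply_eq_neg_integral_mul_divergence {n : ℕ}
    {w : EuclideanSpace ℝ (Fin n) → ℝ} (hw : ContDiff ℝ 1 w) (hsupp : HasCompactSupport w)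
    {V : EuclideanSpace ℝ (Fin n) → EuclideanSpace ℝ (Fin n)} (hV : ContDiff ℝ 1 V) :
    ∫ x, fderiv ℝ w x (V x) =
      -∫ x, w x * ∑ i, (fderiv ℝ V x (EuclideanSpace.single i 1)) i := by
  have hw' : Continuous (fderiv ℝ w) := hw.continuous_fderiv one_ne_zero
  have hV' : Continuous (fderiv ℝ V) := hV.continuous_fderiv one_ne_zero
  have hdiffV (x) : DifferentiableAt ℝ V x := hV.differentiable one_ne_zero x
  have hcoord (i : Fin n) (x) :
      HasFDerivAt (fun y => V y i) ((EuclideanSpace.proj i).comp (fderiv ℝ V x)) x :=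
    (EuclideanSpace.proj (𝕜 := ℝ) i).hasFDerivAt.comp x (hdiffV x).hasFDerivAt
  have hcoord_cont (i : Fin n) : Continuous fun x => V x i :=
    (EuclideanSpace.proj (𝕜 := ℝ) i).continuous.comp hV.continuous
  have hdiv_cont (i : Fin n) :
      Continuous fun x => (fderiv ℝ V x (EuclideanSpace.single i 1)) i :=
    (EuclideanSpace.proj (𝕜 := ℝ) i).continuous.comp (hV'.clm_apply continuous_const)
  have hint_left (i : Fin n) :
      Integrable fun x => fderiv ℝ w x (EuclideanSpace.single i 1) * V x i :=
    ((hw'.clm_apply continuous_const).mul (hcoord_cont i)).integrable_of_hasCompactSupport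
      (hsupp.fderiv_apply ℝ _).mul_right
  have hint_right (i : Fin n) :
      Integrable fun x => w x * (fderiv ℝ V x (EuclideanSpace.single i 1)) i :=
    (hw.continuous.mul (hdiv_cont i)).integrable_of_hasCompactSupport hsupp.mul_right
  have hparts (i : Fin n) :
      ∫ x, fderiv ℝ w x (EuclideanSpace.single i 1) * V x i =
        -∫ x, w x * (fderiv ℝ V x (EuclideanSpace.single i 1)) i := by
    have h := integral_bilinear_hasFDerivAt_right_eq_neg_left_of_integrable
      (μ := volume) (B := ContinuousLinearMap.mul ℝ ℝ) (f := w) (f' := fderiv ℝ w)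
      (g := fun x => V x i) (g' := fun x => (EuclideanSpace.proj i).comp (fderiv ℝ V x))
      (v := EuclideanSpace.single i 1) (hint_left i) (hint_right i)
      ((hw.continuous.mul (hcoord_cont i)).integrable_of_hasCompactSupport hsupp.mul_right)
      (fun x _ => (hw.differentiable one_ne_zero x).hasFDerivAt) (fun x _ => hcoord i x)
    exact (neg_eq_iff_eq_neg.2 h).symm
  have hexpand (x) :
      fderiv ℝ w x (V x) = ∑ i, fderiv ℝ w x (EuclideanSpace.single i 1) * V x i := by
    conv_lhs => rw [← (EuclideanSpace.basisFun (Fin n) ℝ).sum_repr (V x)]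
    simp [mul_comm]
  simp_rw [hexpand, Finset.mul_sum]
  rw [integral_finsetSum _ fun i _ => hint_left i, integral_finsetSum _ fun i _ => hint_right i,
    ← Finset.sum_neg_distrib]
  exact Finset.sum_congr rfl fun i _ => hparts i

/-- The divergence of the regularised field `x ↦ (x - a) / (‖x - a‖ ^ 2 + ε)`. -/
lemma divergence_regularized_inv_field {n : ℕ} (a x : EuclideanSpace ℝ (Fin n)) {ε : ℝ}
    (hε : 0 < ε) :
    ∑ i, (fderiv ℝ (fun y => (‖y - a‖ ^ 2 + ε)⁻¹ • (y - a)) x (EuclideanSpace.single i 1)) i =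
      n * (‖x - a‖ ^ 2 + ε)⁻¹ - 2 * ‖x - a‖ ^ 2 * ((‖x - a‖ ^ 2 + ε)⁻¹) ^ 2 := by
  have hne : ‖x - a‖ ^ 2 + ε ≠ 0 := by positivity
  have hsub : HasFDerivAt (fun y => y - a) (ContinuousLinearMap.id ℝ _) x :=
    (hasFDerivAt_id x).sub_const a
  have hinv := (hasDerivAt_inv hne).comp_hasFDerivAt x (hsub.norm_sq.add_const ε)
  have hfield := hinv.smul hsub
  have hterm (i : Fin n) :
      (fderiv ℝ (fun y => (‖y - a‖ ^ 2 + ε)⁻¹ • (y - a)) x (EuclideanSpace.single i 1)) i =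
        (‖x - a‖ ^ 2 + ε)⁻¹ - 2 * ((‖x - a‖ ^ 2 + ε)⁻¹) ^ 2 * (x - a) i ^ 2 := by
    have h : fderiv ℝ (fun y => (‖y - a‖ ^ 2 + ε)⁻¹ • (y - a)) x = _ := hfield.fderiv
    rw [h]
    simp [EuclideanSpace.inner_single_right]
    ring
  simp_rw [hterm, Finset.sum_sub_distrib, ← Finset.mul_sum, ← EuclideanSpace.real_norm_sq_eq]
  simp
  ring

lemma integrable_mul_inv_norm_sub_sq {n : ℕ} (hn : 3 ≤ n) (a : EuclideanSpace ℝ (Fin n))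
    {f : EuclideanSpace ℝ (Fin n) → ℝ} (hf : Continuous f) (hsupp : HasCompactSupport f) :
    Integrable fun x => f x * (‖x - a‖ ^ 2)⁻¹ :=
  have hloc := locallyIntegrable_inv_norm_sub_sq volume (by simpa using hn) a
  hloc.integrable_smul_left_of_hasCompactSupport hf hsupp

/-- Dominated convergence for the regularisation `(‖x - a‖ ^ 2 + ε)⁻¹` of `(‖x - a‖ ^ 2)⁻¹`. -/
lemma tendsto_integral_of_le_inv_norm_sub_sq {n : ℕ} (hn : 3 ≤ n) (a : EuclideanSpace ℝ (Fin n))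
    {f : EuclideanSpace ℝ (Fin n) → ℝ} (hf : Continuous f) (hsupp : HasCompactSupport f)
    {c C : ℝ} {φ : ℝ → ℝ → ℝ}
    (hcont : ∀ ε > 0, Continuous fun x : EuclideanSpace ℝ (Fin n) => φ ε ‖x - a‖)
    (hbound : ∀ ε > 0, ∀ r > 0, |φ ε r| ≤ C * (r ^ 2)⁻¹)
    (hlim : ∀ r > 0, Tendsto (fun ε => φ ε r) (𝓝[>] 0) (𝓝 (c * (r ^ 2)⁻¹))) :
    Tendsto (fun ε => ∫ x, f x * φ ε ‖x - a‖) (𝓝[>] 0)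
      (𝓝 (c * ∫ x, f x * (‖x - a‖ ^ 2)⁻¹)) := by
  have : Nontrivial (EuclideanSpace ℝ (Fin n)) :=
    Module.nontrivial_of_finrank_pos (R := ℝ) (by simp; omega)
  have hne : ∀ᵐ x : EuclideanSpace ℝ (Fin n), 0 < ‖x - a‖ := by
    filter_upwards [Measure.ae_ne volume a] with x hx
    exact norm_pos_iff.2 (sub_ne_zero.2 hx)
  rw [← integral_const_mul]
  refine tendsto_integral_filter_of_dominated_convergence
    (fun x => C * ‖f x * (‖x - a‖ ^ 2)⁻¹‖) ?_ ?_
    ((integrable_mul_inv_norm_sub_sq hn a hf hsupp).norm.const_mul C) ?_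
  · filter_upwards [self_mem_nhdsWithin] with ε hε
    exact (hf.mul (hcont ε hε)).aestronglyMeasurable
  · filter_upwards [self_mem_nhdsWithin] with ε hε
    filter_upwards [hne] with x hx
    have hinv : 0 ≤ (‖x - a‖ ^ 2)⁻¹ := by positivity
    rw [norm_mul, norm_mul, Real.norm_eq_abs (φ _ _), Real.norm_of_nonneg hinv]
    calc ‖f x‖ * |φ ε ‖x - a‖| ≤ ‖f x‖ * (C * (‖x - a‖ ^ 2)⁻¹) := by
          gcongr
          exact hbound ε hε _ hx
      _ = C * (‖f x‖ * (‖x - a‖ ^ 2)⁻¹) := by ring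
  · filter_upwards [hne] with x hx
    convert (hlim _ hx).const_mul (f x) using 2
    ring

theorem divergence_theorem_singular_field
    (n : ℕ) (hn : 3 ≤ n) (a : EuclideanSpace ℝ (Fin n))
    (u : EuclideanSpace ℝ (Fin n) → ℝ)
    (hu : ContDiff ℝ (⊤ : ℕ∞) u) (hsupp : HasCompactSupport u) :
    Integrable (fun x : EuclideanSpace ℝ (Fin n) =>
        inner (𝕜 := ℝ) (gradient (fun y => u y ^ 2) x) ((‖x - a‖ ^ 2)⁻¹ • (x - a))) ∧
    Integrable (fun x : EuclideanSpace ℝ (Fin n) => u x ^ 2 / ‖x - a‖ ^ 2) ∧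
    ∫ x : EuclideanSpace ℝ (Fin n),
        inner (𝕜 := ℝ) (gradient (fun y => u y ^ 2) x) ((‖x - a‖ ^ 2)⁻¹ • (x - a)) =
      -((n : ℝ) - 2) * ∫ x : EuclideanSpace ℝ (Fin n), u x ^ 2 / ‖x - a‖ ^ 2 := by
  have hw : ContDiff ℝ 1 fun y => u y ^ 2 := (hu.of_le (by exact_mod_cast le_top)).pow 2
  have hwsupp : HasCompactSupport fun y => u y ^ 2 :=
    hsupp.comp_left (g := fun t : ℝ => t ^ 2) (by simp)
  set w := fun y => u y ^ 2
  have hgrad (x) : inner (𝕜 := ℝ) (gradient w x) ((‖x - a‖ ^ 2)⁻¹ • (x - a)) =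
      fderiv ℝ w x (x - a) * (‖x - a‖ ^ 2)⁻¹ := by
    rw [inner_smul_right, gradient, InnerProductSpace.toDual_symm_apply, mul_comm]
  have hquot (x) : u x ^ 2 / ‖x - a‖ ^ 2 = w x * (‖x - a‖ ^ 2)⁻¹ := div_eq_mul_inv _ _
  have hd : Continuous fun x => fderiv ℝ w x (x - a) :=
    (hw.continuous_fderiv one_ne_zero).clm_apply (continuous_id.sub continuous_const)
  have hdsupp : HasCompactSupport fun x => fderiv ℝ w x (x - a) :=
    (hwsupp.fderiv ℝ).mono fun x hx => by
      contrapose! hx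
      simp_all
  simp_rw [hgrad, hquot]
  refine ⟨integrable_mul_inv_norm_sub_sq hn a hd hdsupp,
    integrable_mul_inv_norm_sub_sq hn a hw.continuous hwsupp, ?_⟩
  have hψcont : ∀ ε > (0 : ℝ),
      Continuous fun x : EuclideanSpace ℝ (Fin n) => (‖x - a‖ ^ 2 + ε)⁻¹ := fun ε hε =>
    Continuous.inv₀ (by fun_prop) fun x => by positivity
  have hψbound : ∀ ε > (0 : ℝ), ∀ r > (0 : ℝ), (r ^ 2 + ε)⁻¹ ≤ (r ^ 2)⁻¹ := fun ε hε r hr => by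
    gcongr
    linarith
  have hψlim : ∀ r > (0 : ℝ),
      Tendsto (fun ε : ℝ => (r ^ 2 + ε)⁻¹) (𝓝[>] 0) (𝓝 (r ^ 2)⁻¹) := fun r hr => by
    have h : ContinuousAt (fun ε : ℝ => (r ^ 2 + ε)⁻¹) 0 :=
      ContinuousAt.inv₀ (by fun_prop) (by positivity)
    simpa using h.tendsto.mono_left nhdsWithin_le_nhds
  have hleft := tendsto_integral_of_le_inv_norm_sub_sq hn a hd hdsupp (c := 1) (C := 1)
    (φ := fun ε r => (r ^ 2 + ε)⁻¹) hψcont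
    (fun ε hε r hr => by
      rw [abs_of_pos (by positivity), one_mul]
      exact hψbound ε hε r hr)
    (fun r hr => by simpa using hψlim r hr)
  have hright := tendsto_integral_of_le_inv_norm_sub_sq hn a hw.continuous hwsupp
    (c := (n : ℝ) - 2) (C := (n : ℝ) + 2)
    (φ := fun ε r => n * (r ^ 2 + ε)⁻¹ - 2 * r ^ 2 * ((r ^ 2 + ε)⁻¹) ^ 2)
    (fun ε hε => by
      have := hψcont ε hε
      fun_prop)
    (fun ε hε r hr => by
      have hle := hψbound ε hε r hr
      have hpos : 0 < (r ^ 2 + ε)⁻¹ := by positivity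
      have hratio : r ^ 2 * (r ^ 2 + ε)⁻¹ ≤ 1 := by
        rw [← div_eq_mul_inv, div_le_one (by positivity)]
        linarith
      have hsq : r ^ 2 * ((r ^ 2 + ε)⁻¹) ^ 2 ≤ (r ^ 2 + ε)⁻¹ := by nlinarith
      have hsq0 : 0 ≤ r ^ 2 * ((r ^ 2 + ε)⁻¹) ^ 2 := by positivity
      have hnle : (n : ℝ) * (r ^ 2 + ε)⁻¹ ≤ n * (r ^ 2)⁻¹ := by gcongr
      have hn0 : 0 ≤ (n : ℝ) * (r ^ 2 + ε)⁻¹ := by positivity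
      rw [abs_le]
      constructor <;> nlinarith)
    (fun r hr => by
      have h := ((hψlim r hr).const_mul (n : ℝ)).sub (((hψlim r hr).pow 2).const_mul (2 * r ^ 2))
      convert h using 2
      field_simp)
  have heq : ∀ᶠ ε in 𝓝[>] (0 : ℝ),
      -∫ x, w x * (n * (‖x - a‖ ^ 2 + ε)⁻¹ - 2 * ‖x - a‖ ^ 2 * ((‖x - a‖ ^ 2 + ε)⁻¹) ^ 2) =
        ∫ x, fderiv ℝ w x (x - a) * (‖x - a‖ ^ 2 + ε)⁻¹ := by
    filter_upwards [self_mem_nhdsWithin] with ε hε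
    have hε : 0 < ε := hε
    have hsub : ContDiff ℝ 1 fun x : EuclideanSpace ℝ (Fin n) => x - a :=
      contDiff_id.sub contDiff_const
    have hV : ContDiff ℝ 1 fun x => (‖x - a‖ ^ 2 + ε)⁻¹ • (x - a) :=
      (((hsub.norm_sq ℝ).add contDiff_const).inv fun x => by positivity).smul hsub
    have h := integral_fderiv_apply_eq_neg_integral_mul_divergence hw hwsupp hV
    simp_rw [divergence_regularized_inv_field a _ hε, map_smul, smul_eq_mul] at h
    rw [← h]
    simp_rw [mul_comm]
  have h := tendsto_nhds_unique hleft (hright.neg.congr' heq)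
  rw [one_mul] at h
  rw [h, neg_mul]
end

section
/- Let n ≥ 3, m ≥ 2, let x₁, …, x_m ∈ ℝⁿ be pairwise distinct points, and let u : ℝⁿ → ℝ be smooth with compact support. Then ∫_{ℝⁿ} ‖∇u(x)‖² dx ≥ −((n−2)²/m²) ∫_{ℝⁿ} ‖∑_{i=1}^m (x − x_i)/‖x − x_i‖²‖² u²(x) dx + ((n−2)²/m) ∑_{i=1}^m ∫_{ℝⁿ} u²(x)/‖x − x_i‖² dx, all integrals being finite (with respect to Lebesgue measure). -/
open MeasureTheory

section HardyIdentity

open Metric Set Module Topology Filter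

variable {E : Type*} [NormedAddCommGroup E] [NormedSpace ℝ E] [FiniteDimensional ℝ E]
  [MeasurableSpace E] [BorelSpace E]

theorem integrableOn_ball_inv_norm_sq (μ : Measure E) [μ.IsAddHaarMeasure]
    (hE : 3 ≤ finrank ℝ E) (r : ℝ) :
    IntegrableOn (fun x : E => (‖x‖ ^ 2)⁻¹) (ball 0 r) μ := by
  have : Nontrivial E := Module.nontrivial_of_finrank_pos (R := ℝ) (by omega)
  refine (integrableOn_fun_norm_addHaar μ (f := fun y : ℝ => (y ^ 2)⁻¹)).2 ?_
  have h : IntegrableOn (fun y : ℝ => y ^ (finrank ℝ E - 3)) (Ioo 0 r) :=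
    ((continuous_pow _).integrableOn_Icc (a := 0) (b := r)).mono_set Ioo_subset_Icc_self
  refine h.congr_fun (fun y hy => ?_) measurableSet_Ioo
  have hy0 : y ≠ 0 := hy.1.ne'
  obtain ⟨k, hk⟩ := Nat.exists_eq_add_of_le hE
  simp only [smul_eq_mul, hk, show 3 + k - 3 = k by omega, show 3 + k - 1 = k + 2 by omega]
  field_simp
  rw [← pow_add]

theorem Continuous.integrable_div_norm_sq {μ : Measure E} [μ.IsAddHaarMeasure]
    (hE : 3 ≤ finrank ℝ E) {f : E → ℝ} (hf : Continuous f) (hc : HasCompactSupport f) :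
    Integrable (fun x => f x / ‖x‖ ^ 2) μ := by
  obtain ⟨C, hC⟩ := hc.exists_bound_of_continuous hf
  obtain ⟨r, hr⟩ := hc.isCompact.isBounded.subset_ball 0
  refine (((integrable_indicator_iff measurableSet_ball).2
    (integrableOn_ball_inv_norm_sq μ hE r)).const_mul C).mono'
    (hf.measurable.div (by fun_prop)).aestronglyMeasurable (.of_forall fun x => ?_)
  by_cases hx : x ∈ ball (0 : E) r
  · rw [indicator_of_mem hx, norm_div, div_eq_mul_inv, norm_pow, norm_norm]
    gcongr
    exact hC x
  · simp [image_eq_zero_of_notMem_tsupport fun h => hx (hr h), indicator_of_notMem hx]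

/-- Differentiating `t ↦ ∫ f (t • x) / ‖x‖ ^ 2` at `t = 1` gives the integration by parts formula
for the vector field `x / ‖x‖ ^ 2`, without regularization at the pole. -/
theorem integral_fderiv_apply_self_div_norm_sq {μ : Measure E} [μ.IsAddHaarMeasure]
    (hE : 3 ≤ finrank ℝ E) {f : E → ℝ} (hf : ContDiff ℝ 1 f) (hc : HasCompactSupport f) :
    Integrable (fun x => fderiv ℝ f x x / ‖x‖ ^ 2) μ ∧
      ∫ x, fderiv ℝ f x x / ‖x‖ ^ 2 ∂μ =
        -((finrank ℝ E : ℝ) - 2) * ∫ x, f x / ‖x‖ ^ 2 ∂μ := by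
  have hf' : Continuous (fderiv ℝ f) := hf.continuous_fderiv one_ne_zero
  obtain ⟨C, hC⟩ := (hc.fderiv ℝ).exists_bound_of_continuous hf'
  obtain ⟨r, hr⟩ := (hc.fderiv ℝ).isCompact.isBounded.subset_ball 0
  have key := hasDerivAt_integral_of_dominated_loc_of_deriv_le (μ := μ) (x₀ := (1 : ℝ))
    (F := fun t x => f (t • x) / ‖x‖ ^ 2) (F' := fun t x => fderiv ℝ f (t • x) x / ‖x‖ ^ 2)
    (s := Ioi (1 / 2))
    (bound := fun x => C * (2 * r) * (ball (0 : E) (2 * r)).indicator (fun y => (‖y‖ ^ 2)⁻¹) x)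
    (Ioi_mem_nhds (by norm_num))
    (.of_forall fun t => ((hf.continuous.comp (continuous_const_smul t)).measurable.div
      (by fun_prop)).aestronglyMeasurable)
    (by simpa using hf.continuous.integrable_div_norm_sq hE hc)
    (Measurable.aestronglyMeasurable (Measurable.div (Continuous.measurable (by fun_prop))
      (by fun_prop)))
    (.of_forall fun x t ht => ?_)
    (((integrable_indicator_iff measurableSet_ball).2
      (integrableOn_ball_inv_norm_sq μ hE (2 * r))).const_mul _)
    (.of_forall fun x t _ => ?_)
  · simp only [one_smul] at key
    refine ⟨key.1, key.2.unique ?_⟩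
    set I := ∫ x, f x / ‖x‖ ^ 2 ∂μ
    obtain ⟨k, hk⟩ := Nat.exists_eq_add_of_le hE
    have hd : HasDerivAt (fun t : ℝ => (t ^ (k + 1))⁻¹ * I)
        (-((finrank ℝ E : ℝ) - 2) * I) 1 := by
      have := ((hasDerivAt_pow (k + 1) (1 : ℝ)).inv (by simp)).mul_const I
      refine this.congr_deriv ?_
      rw [hk]
      push_cast
      simp only [one_pow]
      ring
    refine hd.congr_of_eventuallyEq ?_
    filter_upwards [Ioi_mem_nhds (zero_lt_one' ℝ)] with t (ht : 0 < t)
    have hscale : ∀ x : E, f (t • x) / ‖x‖ ^ 2 = t ^ 2 * (f (t • x) / ‖t • x‖ ^ 2) := by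
      intro x
      rw [norm_smul, mul_pow, Real.norm_eq_abs, sq_abs]
      field_simp
    simp_rw [hscale]
    rw [integral_const_mul, Measure.integral_comp_smul μ (fun x => f x / ‖x‖ ^ 2), hk,
      abs_of_pos (by positivity), smul_eq_mul, show 3 + k = (k + 1) + 2 by omega, pow_add]
    field_simp
    rfl
  · by_cases hx : t • x ∈ ball (0 : E) r
    · have ht0 : (1 / 2 : ℝ) < t := ht
      have hn : ‖x‖ < 2 * r := by
        rw [mem_ball_zero_iff, norm_smul, Real.norm_of_nonneg (by linarith)] at hx
        nlinarith [norm_nonneg x]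
      rw [indicator_of_mem (mem_ball_zero_iff.2 hn), norm_div, div_eq_mul_inv, norm_pow, norm_norm]
      gcongr
      exact ((fderiv ℝ f (t • x)).le_opNorm x).trans
        (mul_le_mul (hC _) hn.le (norm_nonneg _) ((norm_nonneg _).trans (hC 0)))
    · rw [image_eq_zero_of_notMem_tsupport fun h => hx (hr h)]
      have hC0 : 0 ≤ C := (norm_nonneg _).trans (hC 0)
      by_cases hy : x ∈ ball (0 : E) (2 * r)
      · have : 0 ≤ 2 * r := (pos_of_mem_ball hy).le
        rw [indicator_of_mem hy]
        simp only [zero_apply, zero_div, norm_zero]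
        positivity
      · simp [indicator_of_notMem hy]
  · have h1 : HasDerivAt (fun s : ℝ => s • x) x t := by
      simpa using (hasDerivAt_id t).smul_const x
    exact ((hf.differentiable one_ne_zero (t • x)).hasFDerivAt.comp_hasDerivAt
      t h1).div_const _

theorem Continuous.integrable_div_norm_sub_sq {μ : Measure E} [μ.IsAddHaarMeasure]
    (hE : 3 ≤ finrank ℝ E) {f : E → ℝ} (hf : Continuous f) (hc : HasCompactSupport f) (p : E) :
    Integrable (fun x => f x / ‖x - p‖ ^ 2) μ := by
  have h := (Continuous.integrable_div_norm_sq (μ := μ) hE (hf.comp (continuous_add_const p))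
    (hc.comp_homeomorph (Homeomorph.addRight p))).comp_sub_right p
  simpa using h

theorem integral_fderiv_apply_sub_div_norm_sub_sq {μ : Measure E} [μ.IsAddHaarMeasure]
    (hE : 3 ≤ finrank ℝ E) {f : E → ℝ} (hf : ContDiff ℝ 1 f) (hc : HasCompactSupport f) (p : E) :
    Integrable (fun x => fderiv ℝ f x (x - p) / ‖x - p‖ ^ 2) μ ∧
      ∫ x, fderiv ℝ f x (x - p) / ‖x - p‖ ^ 2 ∂μ =
        -((finrank ℝ E : ℝ) - 2) * ∫ x, f x / ‖x - p‖ ^ 2 ∂μ := by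
  obtain ⟨h1, h2⟩ := integral_fderiv_apply_self_div_norm_sq (μ := μ) hE
    (f := fun x => f (x + p)) (by fun_prop) (hc.comp_homeomorph (Homeomorph.addRight p))
  simp only [fderiv_comp_add_right] at h1 h2
  refine ⟨by simpa using h1.comp_sub_right p, ?_⟩
  rw [← integral_add_right_eq_self _ p, ← integral_add_right_eq_self (fun x => f x / _) p]
  simpa using h2

end HardyIdentity

theorem integrable_norm_fderiv_sq {E : Type*} [NormedAddCommGroup E] [NormedSpace ℝ E]
    [MeasurableSpace E] [OpensMeasurableSpace E] {μ : Measure E} [IsFiniteMeasureOnCompacts μ]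
    {f : E → ℝ} (hf : ContDiff ℝ 1 f) (hc : HasCompactSupport f) :
    Integrable (fun x => ‖fderiv ℝ f x‖ ^ 2) μ := by
  have hcont : Continuous fun x => ‖fderiv ℝ f x‖ := (hf.continuous_fderiv one_ne_zero).norm
  have hsupp : HasCompactSupport fun x => ‖fderiv ℝ f x‖ := (hc.fderiv ℝ).norm
  have hsupp_sq : HasCompactSupport fun x => ‖fderiv ℝ f x‖ ^ 2 :=
    hsupp.comp_left (g := fun y => y ^ 2) (by simp)
  exact (hcont.pow 2).integrable_of_hasCompactSupport hsupp_sq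

theorem norm_sum_inv_norm_sq_smul_sq_le {E ι : Type*} [NormedAddCommGroup E] [NormedSpace ℝ E]
    [Fintype ι] (y : ι → E) :
    ‖∑ i, (‖y i‖ ^ 2)⁻¹ • y i‖ ^ 2 ≤ Fintype.card ι * ∑ i, (‖y i‖ ^ 2)⁻¹ := by
  have hterm : ∀ i, ‖(‖y i‖ ^ 2)⁻¹ • y i‖ ^ 2 = (‖y i‖ ^ 2)⁻¹ := by
    intro i
    rw [norm_smul, norm_inv, norm_pow, norm_norm]
    by_cases h : ‖y i‖ = 0
    · simp [h]
    · field_simp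
  calc ‖∑ i, (‖y i‖ ^ 2)⁻¹ • y i‖ ^ 2 ≤ (∑ i, ‖(‖y i‖ ^ 2)⁻¹ • y i‖) ^ 2 := by
        gcongr
        exact norm_sum_le _ _
    _ ≤ Fintype.card ι * ∑ i, ‖(‖y i‖ ^ 2)⁻¹ • y i‖ ^ 2 := sq_sum_le_card_mul_sum_sq
    _ = _ := by simp_rw [hterm]

theorem euclidean_multipolar_hardy_intermediate
    (n m : ℕ) (hn : 3 ≤ n) (hm : 2 ≤ m)
    (p : Fin m → EuclideanSpace ℝ (Fin n))
    (hp : ∀ i j, i ≠ j → p i ≠ p j)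
    (u : EuclideanSpace ℝ (Fin n) → ℝ)
    (hu : ContDiff ℝ (⊤ : ℕ∞) u) (hsupp : HasCompactSupport u) :
    Integrable (fun x : EuclideanSpace ℝ (Fin n) => ‖gradient u x‖ ^ 2) ∧
    Integrable (fun x : EuclideanSpace ℝ (Fin n) =>
        ‖∑ i, (‖x - p i‖ ^ 2)⁻¹ • (x - p i)‖ ^ 2 * u x ^ 2) ∧
    (∀ i, Integrable (fun x : EuclideanSpace ℝ (Fin n) => u x ^ 2 / ‖x - p i‖ ^ 2)) ∧
    ∫ x : EuclideanSpace ℝ (Fin n), ‖gradient u x‖ ^ 2 ≥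
      -(((n : ℝ) - 2) ^ 2 / (m : ℝ) ^ 2) *
          (∫ x : EuclideanSpace ℝ (Fin n), ‖∑ i, (‖x - p i‖ ^ 2)⁻¹ • (x - p i)‖ ^ 2 * u x ^ 2) +
        (((n : ℝ) - 2) ^ 2 / (m : ℝ)) *
          ∑ i, ∫ x : EuclideanSpace ℝ (Fin n), u x ^ 2 / ‖x - p i‖ ^ 2 := by
  have hE : 3 ≤ Module.finrank ℝ (EuclideanSpace ℝ (Fin n)) := by simpa using hn
  have hu1 : ContDiff ℝ 1 u := hu.of_le (by exact_mod_cast le_top)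
  have hv1 : ContDiff ℝ 1 (fun x => u x ^ 2) := hu1.pow 2
  have hvc : HasCompactSupport (fun x => u x ^ 2) :=
    hsupp.comp_left (g := fun y => y ^ 2) (by simp)
  have hgrad : ∀ x, ‖gradient u x‖ = ‖fderiv ℝ u x‖ := fun x => by
    rw [← toDual_gradient, LinearIsometryEquiv.norm_map]
  have hI1 : Integrable (fun x : EuclideanSpace ℝ (Fin n) => ‖gradient u x‖ ^ 2) := by
    simp_rw [hgrad]
    exact integrable_norm_fderiv_sq hu1 hsupp
  have hI3 : ∀ i, Integrable (fun x : EuclideanSpace ℝ (Fin n) => u x ^ 2 / ‖x - p i‖ ^ 2) :=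
    fun i => hv1.continuous.integrable_div_norm_sub_sq hE hvc (p i)
  have hI2 : Integrable (fun x : EuclideanSpace ℝ (Fin n) =>
      ‖∑ i, (‖x - p i‖ ^ 2)⁻¹ • (x - p i)‖ ^ 2 * u x ^ 2) := by
    refine ((integrable_finsetSum Finset.univ fun i _ => hI3 i).const_mul (m : ℝ)).mono'
      (Measurable.aestronglyMeasurable ?_) (.of_forall fun x => ?_)
    · have := hu.continuous.measurable
      fun_prop
    · have hle := norm_sum_inv_norm_sq_smul_sq_le fun i => x - p i
      rw [Fintype.card_fin] at hle
      rw [Real.norm_of_nonneg (by positivity)]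
      calc _ ≤ (m * ∑ i, (‖x - p i‖ ^ 2)⁻¹) * u x ^ 2 := by gcongr
        _ = _ := by simp_rw [div_eq_mul_inv, ← Finset.mul_sum]; ring
  refine ⟨hI1, hI2, hI3, ?_⟩
  have hparts := fun i => integral_fderiv_apply_sub_div_norm_sub_sq
    (μ := (volume : Measure (EuclideanSpace ℝ (Fin n)))) hE hv1 hvc (p i)
  have hm0 : (m : ℝ) ≠ 0 := by positivity
  set c : ℝ := ((n : ℝ) - 2) / m with hc
  have hsq : ∀ x : EuclideanSpace ℝ (Fin n),
      0 ≤ ‖gradient u x‖ ^ 2 + c * ∑ i, fderiv ℝ (fun x => u x ^ 2) x (x - p i) / ‖x - p i‖ ^ 2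
        + c ^ 2 * (‖∑ i, (‖x - p i‖ ^ 2)⁻¹ • (x - p i)‖ ^ 2 * u x ^ 2) := by
    intro x
    have hd : ∀ y, fderiv ℝ (fun x => u x ^ 2) x y = 2 * u x * inner ℝ (gradient u x) y := by
      intro y
      rw [inner_gradient_left, fderiv_fun_pow 2 (hu1.differentiable one_ne_zero x)]
      simp
    have hsum : ∑ i, fderiv ℝ (fun x => u x ^ 2) x (x - p i) / ‖x - p i‖ ^ 2 =
        2 * u x * inner ℝ (gradient u x) (∑ i, (‖x - p i‖ ^ 2)⁻¹ • (x - p i)) := by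
      rw [inner_sum, Finset.mul_sum]
      refine Finset.sum_congr rfl fun i _ => ?_
      rw [hd, real_inner_smul_right]
      ring
    have h := norm_add_sq_real (gradient u x)
      ((c * u x) • ∑ i, (‖x - p i‖ ^ 2)⁻¹ • (x - p i))
    rw [real_inner_smul_right, norm_smul, mul_pow, Real.norm_eq_abs, sq_abs] at h
    rw [hsum]
    refine (sq_nonneg _).trans_eq (h.trans ?_)
    ring
  have hIG : Integrable (fun x : EuclideanSpace ℝ (Fin n) =>
      c * ∑ i, fderiv ℝ (fun x => u x ^ 2) x (x - p i) / ‖x - p i‖ ^ 2) :=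
    (integrable_finsetSum Finset.univ fun i _ => (hparts i).1).const_mul c
  have hint := integral_nonneg_of_ae (μ := volume) (.of_forall hsq)
  have hIs : Integrable (fun x : EuclideanSpace ℝ (Fin n) => ‖gradient u x‖ ^ 2 +
      c * ∑ i, fderiv ℝ (fun x => u x ^ 2) x (x - p i) / ‖x - p i‖ ^ 2) := hI1.add hIG
  rw [integral_add hIs (hI2.const_mul _), integral_add hI1 hIG, integral_const_mul,
    integral_const_mul, integral_finsetSum _ fun i _ => (hparts i).1,
    Finset.sum_congr rfl fun i _ => (hparts i).2, ← Finset.mul_sum, finrank_euclideanSpace_fin]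
    at hint
  have h1 : ((n : ℝ) - 2) ^ 2 / (m : ℝ) ^ 2 = c ^ 2 := by rw [hc, div_pow]
  have h2 : ((n : ℝ) - 2) ^ 2 / (m : ℝ) = c * ((n : ℝ) - 2) := by rw [hc]; ring
  rw [h1, h2]
  linarith
end

section
/- Let n ≥ 3, m ≥ 2, let x₁, …, x_m ∈ ℝⁿ be pairwise distinct points, and let u : ℝⁿ → ℝ be smooth with compact support. Then ∫_{ℝⁿ} ‖∇u(x)‖² dx ≥ ((n−2)²/m²) ∑_{1 ≤ i < j ≤ m} ∫_{ℝⁿ} ‖(x − x_i)/‖x − x_i‖² − (x − x_j)/‖x − x_j‖²‖² u²(x) dx. -/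
open MeasureTheory

section Divergence

variable {E : Type*} [NormedAddCommGroup E] [InnerProductSpace ℝ E] [FiniteDimensional ℝ E]
  [MeasurableSpace E] [BorelSpace E]

theorem integrable_fderiv_apply_add_mul_divergence {ι : Type*} [Fintype ι]
    (b : OrthonormalBasis ι ℝ E) {f : E → ℝ} {W : E → E}
    (hf : ContDiff ℝ 1 f) (hW : ContDiff ℝ 1 W) (hc : HasCompactSupport f) :
    Integrable fun x => fderiv ℝ f x (W x) + f x * ∑ k, inner ℝ (b k) (fderiv ℝ W x (b k)) := by
  have hf' := hf.continuous_fderiv one_ne_zero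
  have hW' := hW.continuous_fderiv one_ne_zero
  have hfc := hf.continuous
  have hWc := hW.continuous
  refine Integrable.add ?_ ?_
  · refine Continuous.integrable_of_hasCompactSupport (by fun_prop) ?_
    refine (hc.fderiv (𝕜 := ℝ)).mono fun x hx => ?_
    contrapose! hx
    simp_all
  · exact Continuous.integrable_of_hasCompactSupport (by fun_prop) hc.mul_right

/-- The divergence theorem for the compactly supported vector field `f • W`. -/
theorem integral_fderiv_apply_add_mul_divergence {ι : Type*} [Fintype ι]
    (b : OrthonormalBasis ι ℝ E) {f : E → ℝ} {W : E → E}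
    (hf : ContDiff ℝ 1 f) (hW : ContDiff ℝ 1 W) (hc : HasCompactSupport f) :
    ∫ x, (fderiv ℝ f x (W x) + f x * ∑ k, inner ℝ (b k) (fderiv ℝ W x (b k))) = 0 := by
  have hf' := hf.continuous_fderiv one_ne_zero
  have hW' := hW.continuous_fderiv one_ne_zero
  have hfc := hf.continuous
  have hWc := hW.continuous
  have hdW : Differentiable ℝ W := hW.differentiable one_ne_zero
  have hd : ∀ k x, fderiv ℝ (fun y => inner ℝ (b k) (W y)) x (b k)
      = inner ℝ (b k) (fderiv ℝ W x (b k)) := fun k x => by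
    simp [fderiv_inner_apply ℝ (differentiableAt_const (b k)) (hdW x)]
  have hi1 : ∀ k, Integrable fun x => fderiv ℝ f x (b k) * inner ℝ (b k) (W x) := fun k =>
    Continuous.integrable_of_hasCompactSupport (by fun_prop)
      ((hc.fderiv_apply (𝕜 := ℝ) (b k)).mul_right)
  have hi2 : ∀ k, Integrable fun x => f x * inner ℝ (b k) (fderiv ℝ W x (b k)) := fun k =>
    Continuous.integrable_of_hasCompactSupport (by fun_prop) hc.mul_right
  have key : ∀ k, ∫ x, (fderiv ℝ f x (b k) * inner ℝ (b k) (W x)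
      + f x * inner ℝ (b k) (fderiv ℝ W x (b k))) = 0 := fun k => by
    have h := integral_mul_fderiv_eq_neg_fderiv_mul_of_integrable (μ := (volume : Measure E))
      (f := f) (g := fun y => inner ℝ (b k) (W y)) (v := b k) (hi1 k)
      (by simpa only [hd] using hi2 k)
      (Continuous.integrable_of_hasCompactSupport (by fun_prop) hc.mul_right)
      (fun x _ => hf.differentiable one_ne_zero x)
      (fun x _ => (differentiableAt_const _).inner ℝ (hdW x))
    simp only [hd] at h
    rw [integral_add (hi1 k) (hi2 k), h, add_neg_cancel]
  calc ∫ x, (fderiv ℝ f x (W x) + f x * ∑ k, inner ℝ (b k) (fderiv ℝ W x (b k)))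
      = ∫ x, ∑ k, (fderiv ℝ f x (b k) * inner ℝ (b k) (W x)
          + f x * inner ℝ (b k) (fderiv ℝ W x (b k))) := by
        congr 1 with x
        rw [Finset.sum_add_distrib, Finset.mul_sum]
        congr 1
        conv_lhs => rw [← b.sum_repr' (W x)]
        simp [mul_comm]
    _ = 0 := by
        rw [integral_finsetSum]
        · exact Finset.sum_eq_zero fun k _ => key k
        · exact fun k _ => (hi1 k).add (hi2 k)

end Divergence

section RegularizedField

variable {E : Type*} [NormedAddCommGroup E] [InnerProductSpace ℝ E]

/-- The field `(x - p) / (‖x - p‖ ^ 2 + ε)`, a smooth approximation of `(x - p) / ‖x - p‖ ^ 2`. -/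
noncomputable def regularizedField (p : E) (ε : ℝ) (x : E) : E :=
  (‖x - p‖ ^ 2 + ε)⁻¹ • (x - p)

theorem contDiff_regularizedField (p : E) {ε : ℝ} (hε : 0 < ε) :
    ContDiff ℝ 1 (regularizedField p ε) := by
  unfold regularizedField
  refine ContDiff.smul (ContDiff.inv ?_ fun x => by positivity) (by fun_prop)
  exact ((contDiff_id.sub contDiff_const).norm_sq ℝ).add contDiff_const

theorem fderiv_regularizedField_apply (p : E) {ε : ℝ} (hε : 0 < ε) (x v : E) :
    fderiv ℝ (regularizedField p ε) x v = (‖x - p‖ ^ 2 + ε)⁻¹ • v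
      - (2 * inner ℝ (x - p) v / (‖x - p‖ ^ 2 + ε) ^ 2) • (x - p) := by
  have h1 : HasFDerivAt (fun y : E => y - p) (ContinuousLinearMap.id ℝ E) x :=
    (hasFDerivAt_id x).sub_const p
  have h2 := (h1.norm_sq).add_const ε
  have hne : ‖x - p‖ ^ 2 + ε ≠ 0 := by positivity
  have h3 := (hasDerivAt_inv hne).comp_hasFDerivAt x h2
  have h4 := h3.smul h1
  have h5 : fderiv ℝ (regularizedField p ε) x = _ := h4.fderiv
  rw [h5]
  simp only [Function.comp_apply, add_apply, smul_apply,
    ContinuousLinearMap.smulRight_apply, ContinuousLinearMap.comp_apply,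
    ContinuousLinearMap.id_apply, innerSL_apply_apply, sub_eq_add_neg, ← neg_smul]
  congr 2
  simp only [smul_eq_mul, nsmul_eq_mul]
  field_simp
  simp [mul_comm]

theorem divergence_regularizedField {ι : Type*} [Fintype ι] (b : OrthonormalBasis ι ℝ E)
    (p : E) {ε : ℝ} (hε : 0 < ε) (x : E) :
    ∑ k, inner ℝ (b k) (fderiv ℝ (regularizedField p ε) x (b k))
      = Fintype.card ι / (‖x - p‖ ^ 2 + ε) - 2 * ‖x - p‖ ^ 2 / (‖x - p‖ ^ 2 + ε) ^ 2 := by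
  have h := b.sum_inner_mul_inner (x - p) (x - p)
  rw [real_inner_self_eq_norm_sq] at h
  simp only [fderiv_regularizedField_apply p hε]
  generalize x - p = y at h ⊢
  generalize ‖y‖ ^ 2 + ε = d
  simp only [inner_sub_right, inner_smul_right, real_inner_self_eq_norm_sq, b.norm_eq_one,
    Finset.sum_sub_distrib]
  rw [← h, Finset.mul_sum, Finset.sum_div]
  congr 1
  · simp [div_eq_mul_inv]
  · exact Finset.sum_congr rfl fun k _ => by ring

theorem norm_regularizedField_sq_mul_le {ι : Type*} [Fintype ι] (b : OrthonormalBasis ι ℝ E)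
    (hcard : 2 ≤ Fintype.card ι) (p : E) {ε : ℝ} (hε : 0 < ε) (x : E) :
    ((Fintype.card ι : ℝ) - 2) * ‖regularizedField p ε x‖ ^ 2
      ≤ ∑ k, inner ℝ (b k) (fderiv ℝ (regularizedField p ε) x (b k)) := by
  rw [divergence_regularizedField b p hε, regularizedField, norm_smul, mul_pow, norm_inv, inv_pow,
    Real.norm_eq_abs, sq_abs]
  have hn : (2 : ℝ) ≤ Fintype.card ι := by exact_mod_cast hcard
  have hd : 0 < ‖x - p‖ ^ 2 + ε := by positivity
  rw [← sub_nonneg]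
  have : (Fintype.card ι : ℝ) / (‖x - p‖ ^ 2 + ε) - 2 * ‖x - p‖ ^ 2 / (‖x - p‖ ^ 2 + ε) ^ 2
      - ((Fintype.card ι : ℝ) - 2) * (((‖x - p‖ ^ 2 + ε) ^ 2)⁻¹ * ‖x - p‖ ^ 2)
      = Fintype.card ι * ε / (‖x - p‖ ^ 2 + ε) ^ 2 := by
    field_simp
    ring
  rw [this]
  positivity

theorem tendsto_regularizedField (p x : E) :
    Filter.Tendsto (fun k : ℕ => regularizedField p (1 / ((k : ℝ) + 1)) x) Filter.atTop
      (nhds ((‖x - p‖ ^ 2)⁻¹ • (x - p))) := by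
  rcases eq_or_ne x p with rfl | hx
  · simp [regularizedField]
  · refine Filter.Tendsto.smul_const (Filter.Tendsto.inv₀ ?_ ?_) _
    · simpa using tendsto_one_div_add_atTop_nhds_zero_nat.const_add (‖x - p‖ ^ 2)
    · have := norm_pos_iff.2 (sub_ne_zero.2 hx)
      positivity

end RegularizedField

theorem sum_ite_lt_norm_sub_sq {E : Type*} [NormedAddCommGroup E] [InnerProductSpace ℝ E] {m : ℕ}
    (w : Fin m → E) :
    ∑ i, ∑ j, (if i < j then ‖w i - w j‖ ^ 2 else 0) = m * ∑ i, ‖w i‖ ^ 2 - ‖∑ i, w i‖ ^ 2 := by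
  have hfull : ∑ i, ∑ j, ‖w i - w j‖ ^ 2 = 2 * (m * ∑ i, ‖w i‖ ^ 2 - ‖∑ i, w i‖ ^ 2) := by
    have h : ‖∑ i, w i‖ ^ 2 = ∑ i, ∑ j, inner ℝ (w i) (w j) := by
      simp only [← real_inner_self_eq_norm_sq, sum_inner, inner_sum]
      exact Finset.sum_comm
    simp only [norm_sub_sq_real, Finset.sum_add_distrib, Finset.sum_sub_distrib, h,
      ← Finset.mul_sum, Finset.sum_const, Finset.card_univ, Fintype.card_fin, nsmul_eq_mul]
    ring
  have hswap : ∑ i, ∑ j, (if j < i then ‖w i - w j‖ ^ 2 else 0)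
      = ∑ i, ∑ j, (if i < j then ‖w i - w j‖ ^ 2 else 0) := by
    rw [Finset.sum_comm]
    simp only [norm_sub_rev]
  have hsplit : ∑ i, ∑ j, ‖w i - w j‖ ^ 2
      = ∑ i, ∑ j, (if i < j then ‖w i - w j‖ ^ 2 else 0)
        + ∑ i, ∑ j, (if j < i then ‖w i - w j‖ ^ 2 else 0) := by
    simp only [← Finset.sum_add_distrib]
    refine Finset.sum_congr rfl fun i _ => Finset.sum_congr rfl fun j _ => ?_
    rcases lt_trichotomy i j with h | rfl | h
    · simp [h, h.not_gt]
    · simp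
    · simp [h, h.not_gt]
  linarith

/-- If nonnegative integrable functions with integrals at most `C` converge pointwise to `f`,
then `f` is integrable with integral at most `C`. -/
theorem integrable_and_integral_le_of_tendsto {α : Type*} [MeasurableSpace α] {μ : Measure α}
    {F : ℕ → α → ℝ} {f : α → ℝ} {C : ℝ} (hmeas : ∀ k, Measurable (F k))
    (hFint : ∀ k, Integrable (F k) μ) (hnonneg : ∀ k x, 0 ≤ F k x)
    (hlim : ∀ x, Filter.Tendsto (fun k => F k x) Filter.atTop (nhds (f x)))
    (hC : ∀ k, ∫ x, F k x ∂μ ≤ C) : Integrable f μ ∧ ∫ x, f x ∂μ ≤ C := by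
  have hf : Measurable f := measurable_of_tendsto_metrizable hmeas (tendsto_pi_nhds.2 hlim)
  have hf0 : ∀ x, 0 ≤ f x := fun x => ge_of_tendsto' (hlim x) fun k => hnonneg k x
  have hC0 : 0 ≤ C := (integral_nonneg (hnonneg 0)).trans (hC 0)
  have hle : ∫⁻ x, ENNReal.ofReal (f x) ∂μ ≤ ENNReal.ofReal C := by
    calc ∫⁻ x, ENNReal.ofReal (f x) ∂μ
        = ∫⁻ x, Filter.liminf (fun k => ENNReal.ofReal (F k x)) Filter.atTop ∂μ := by
          congr 1 with x
          exact (ENNReal.tendsto_ofReal (hlim x)).liminf_eq.symm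
      _ ≤ Filter.liminf (fun k => ∫⁻ x, ENNReal.ofReal (F k x) ∂μ) Filter.atTop :=
          lintegral_liminf_le fun k => (hmeas k).ennreal_ofReal
      _ ≤ ENNReal.ofReal C := by
          refine Filter.liminf_le_of_frequently_le' (Filter.Frequently.of_forall fun k => ?_)
          rw [← ofReal_integral_eq_lintegral_ofReal (hFint k) (.of_forall (hnonneg k))]
          exact ENNReal.ofReal_le_ofReal (hC k)
  refine ⟨⟨hf.aestronglyMeasurable, ?_⟩, ?_⟩
  · rw [hasFiniteIntegral_iff_ofReal (.of_forall hf0)]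
    exact hle.trans_lt ENNReal.ofReal_lt_top
  · rw [integral_eq_lintegral_of_nonneg_ae (.of_forall hf0) hf.aestronglyMeasurable]
    exact ENNReal.toReal_le_of_le_ofReal hC0 hle

theorem integral_regularized_multipolar_hardy {n m : ℕ} (hn : 3 ≤ n) (hm : 0 < m)
    (p : Fin m → EuclideanSpace ℝ (Fin n)) {u : EuclideanSpace ℝ (Fin n) → ℝ}
    (hu : ContDiff ℝ 1 u) (hsupp : HasCompactSupport u) {ε : ℝ} (hε : 0 < ε) :
    ((n : ℝ) - 2) ^ 2 / (m : ℝ) ^ 2 *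
        ∫ x, (∑ i, ∑ j, (if i < j then
          ‖regularizedField (p i) ε x - regularizedField (p j) ε x‖ ^ 2 else 0)) * u x ^ 2
      ≤ ∫ x, ‖gradient u x‖ ^ 2 := by
  have hm' : (m : ℝ) ≠ 0 := by positivity
  have hn' : (0 : ℝ) < (n : ℝ) - 2 := by
    have : (3 : ℝ) ≤ n := by exact_mod_cast hn
    linarith
  set a : ℝ := ((n : ℝ) - 2) / m with ha
  have ha0 : 0 ≤ a := by positivity
  let b := EuclideanSpace.basisFun (Fin n) ℝ
  let W : Fin m → EuclideanSpace ℝ (Fin n) → EuclideanSpace ℝ (Fin n) :=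
    fun i => regularizedField (p i) ε
  let D : Fin m → EuclideanSpace ℝ (Fin n) → ℝ :=
    fun i x => ∑ k, inner ℝ (b k) (fderiv ℝ (W i) x (b k))
  have hW : ∀ i, ContDiff ℝ 1 (W i) := fun i => contDiff_regularizedField (p i) hε
  have husq : ContDiff ℝ 1 fun x => u x ^ 2 := hu.pow 2
  have hcsq : HasCompactSupport fun x => u x ^ 2 := hsupp.comp_left (g := fun t => t ^ 2) (by simp)
  let G : Fin m → EuclideanSpace ℝ (Fin n) → ℝ :=
    fun i x => fderiv ℝ (fun y => u y ^ 2) x (W i x) + u x ^ 2 * D i x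
  have hG : ∀ i, Integrable (G i) := fun i =>
    integrable_fderiv_apply_add_mul_divergence b husq (hW i) hcsq
  have hG0 : ∀ i, ∫ x, G i x = 0 := fun i =>
    integral_fderiv_apply_add_mul_divergence b husq (hW i) hcsq
  have hdu : ∀ x v, fderiv ℝ (fun y => u y ^ 2) x v = 2 * u x * inner ℝ (gradient u x) v :=
    fun x v => by
      rw [fderiv_fun_pow 2 (hu.differentiable one_ne_zero x), inner_gradient_left]
      simp
  have hgrad : Integrable fun x => ‖gradient u x‖ ^ 2 := by
    have h : ∀ x, ‖gradient u x‖ = ‖fderiv ℝ u x‖ := fun x => by simp [gradient]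
    simp only [h]
    have := hu.continuous_fderiv one_ne_zero
    exact Continuous.integrable_of_hasCompactSupport (by fun_prop)
      ((hsupp.fderiv (𝕜 := ℝ)).comp_left (g := fun t => ‖t‖ ^ 2) (by simp))
  have hDge : ∀ i x, ((n : ℝ) - 2) * ‖W i x‖ ^ 2 ≤ D i x := fun i x => by
    simpa using norm_regularizedField_sq_mul_le b (by simpa using by omega) (p i) hε x
  have hpt : ∀ x, a ^ 2 * ((∑ i, ∑ j, (if i < j then ‖W i x - W j x‖ ^ 2 else 0)) * u x ^ 2)
      ≤ ‖gradient u x‖ ^ 2 + a * ∑ i, G i x := fun x => by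
    have hsq : 0 ≤ ‖gradient u x + (a * u x) • ∑ i, W i x‖ ^ 2 := by positivity
    rw [norm_add_sq_real, inner_smul_right, inner_sum, norm_smul, mul_pow, Real.norm_eq_abs,
      sq_abs] at hsq
    have hGx : ∑ i, G i x = 2 * u x * ∑ i, inner ℝ (gradient u x) (W i x)
        + u x ^ 2 * ∑ i, D i x := by
      simp only [G, hdu, Finset.sum_add_distrib, Finset.mul_sum]
    have hD : ((n : ℝ) - 2) * ∑ i, ‖W i x‖ ^ 2 ≤ ∑ i, D i x := by
      rw [Finset.mul_sum]
      exact Finset.sum_le_sum fun i _ => hDge i x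
    have ham : (n : ℝ) - 2 = a * m := by rw [ha]; field_simp
    have hD' := mul_le_mul_of_nonneg_left hD (mul_nonneg ha0 (sq_nonneg (u x)))
    rw [ham] at hD'
    rw [sum_ite_lt_norm_sub_sq, hGx]
    linarith
  have hS : Integrable fun x =>
      (∑ i, ∑ j, (if i < j then ‖W i x - W j x‖ ^ 2 else 0)) * u x ^ 2 := by
    have hWc := fun i => (hW i).continuous
    have huc := hu.continuous
    refine Continuous.integrable_of_hasCompactSupport ?_ hcsq.mul_left
    refine Continuous.mul (continuous_finsetSum _ fun i _ => continuous_finsetSum _ fun j _ => ?_)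
      (by fun_prop)
    split_ifs <;> fun_prop
  rw [← div_pow, ← ha, ← integral_const_mul]
  have hsum : Integrable fun x => ∑ i, G i x := integrable_finsetSum _ fun i _ => hG i
  calc _ ≤ ∫ x, (‖gradient u x‖ ^ 2 + a * ∑ i, G i x) :=
        integral_mono (hS.const_mul _) (hgrad.add (hsum.const_mul a)) hpt
    _ = ∫ x, ‖gradient u x‖ ^ 2 := by
        rw [integral_add hgrad (hsum.const_mul a), integral_const_mul,
          integral_finsetSum _ fun i _ => hG i]
        simp [hG0]

theorem euclidean_multipolar_hardy
    (n m : ℕ) (hn : 3 ≤ n) (hm : 2 ≤ m)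
    (p : Fin m → EuclideanSpace ℝ (Fin n))
    (hp : ∀ i j, i ≠ j → p i ≠ p j)
    (u : EuclideanSpace ℝ (Fin n) → ℝ)
    (hu : ContDiff ℝ (⊤ : ℕ∞) u) (hsupp : HasCompactSupport u) :
    ∫ x : EuclideanSpace ℝ (Fin n), ‖gradient u x‖ ^ 2 ≥
      (((n : ℝ) - 2) ^ 2 / (m : ℝ) ^ 2) *
        ∑ i, ∑ j, (if i < j then
          ∫ x : EuclideanSpace ℝ (Fin n),
            ‖(‖x - p i‖ ^ 2)⁻¹ • (x - p i) - (‖x - p j‖ ^ 2)⁻¹ • (x - p j)‖ ^ 2 * u x ^ 2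
          else 0) := by
  have hc : 0 < ((n : ℝ) - 2) ^ 2 / (m : ℝ) ^ 2 := by
    have : (3 : ℝ) ≤ n := by exact_mod_cast hn
    have : (0 : ℝ) < (n : ℝ) - 2 := by linarith
    positivity
  have hu1 : ContDiff ℝ 1 u := hu.of_le (by exact_mod_cast le_top)
  have huc := hu.continuous
  let T : Fin m → Fin m → EuclideanSpace ℝ (Fin n) → ℝ := fun i j x => if i < j then
    ‖(‖x - p i‖ ^ 2)⁻¹ • (x - p i) - (‖x - p j‖ ^ 2)⁻¹ • (x - p j)‖ ^ 2 * u x ^ 2 else 0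
  let F : ℕ → EuclideanSpace ℝ (Fin n) → ℝ := fun k x =>
    (∑ i, ∑ j, (if i < j then ‖regularizedField (p i) (1 / ((k : ℝ) + 1)) x
      - regularizedField (p j) (1 / ((k : ℝ) + 1)) x‖ ^ 2 else 0)) * u x ^ 2
  have hFc : ∀ k, Continuous (F k) := fun k => by
    have hW : ∀ i, Continuous (regularizedField (p i) (1 / ((k : ℝ) + 1))) := fun i =>
      (contDiff_regularizedField (p i) (by positivity)).continuous
    refine Continuous.mul (continuous_finsetSum _ fun i _ => continuous_finsetSum _ fun j _ => ?_)
      (by fun_prop)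
    split_ifs <;> fun_prop
  have hF0 : ∀ k x, 0 ≤ F k x := fun k x => by
    refine mul_nonneg (Finset.sum_nonneg fun i _ => Finset.sum_nonneg fun j _ => ?_) (sq_nonneg _)
    split_ifs <;> positivity
  have hT0 : ∀ i j x, 0 ≤ T i j x := fun i j x => by
    dsimp only [T]
    split_ifs <;> positivity
  obtain ⟨hFint, hle⟩ := integrable_and_integral_le_of_tendsto (μ := volume) (F := F)
    (f := fun x => ∑ i, ∑ j, T i j x)
    (C := (∫ x, ‖gradient u x‖ ^ 2) / (((n : ℝ) - 2) ^ 2 / (m : ℝ) ^ 2))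
    (fun k => (hFc k).measurable)
    (fun k => (hFc k).integrable_of_hasCompactSupport
      (HasCompactSupport.mul_left (hsupp.comp_left (g := fun t => t ^ 2) (by simp))))
    hF0
    (fun x => by
      simp only [F, Finset.sum_mul, T]
      refine tendsto_finsetSum _ fun i _ => tendsto_finsetSum _ fun j _ => ?_
      split_ifs
      · exact (((tendsto_regularizedField _ x).sub (tendsto_regularizedField _ x)).norm.pow
          2).mul_const _
      · simp)
    (fun k => by
      rw [le_div_iff₀' hc]
      exact integral_regularized_multipolar_hardy hn (by omega) p hu1 hsupp (by positivity))
  have hTint : ∀ i j, Integrable (T i j) := fun i j => by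
    refine hFint.mono' ?_ (.of_forall fun x => ?_)
    · refine Measurable.aestronglyMeasurable ?_
      dsimp only [T]
      split_ifs <;> fun_prop
    · rw [Real.norm_of_nonneg (hT0 i j x)]
      exact (Finset.single_le_sum (f := fun j => T i j x) (fun j _ => hT0 i j x)
        (Finset.mem_univ j)).trans (Finset.single_le_sum (f := fun i => ∑ j, T i j x)
          (fun i _ => Finset.sum_nonneg fun j _ => hT0 i j x) (Finset.mem_univ i))
  rw [le_div_iff₀' hc, integral_finsetSum _ fun i _ => integrable_finsetSum _ fun j _ =>
    hTint i j] at hle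
  refine ge_iff_le.2 (le_of_eq_of_le ?_ hle)
  congr 1
  refine Finset.sum_congr rfl fun i _ => ?_
  rw [integral_finsetSum _ fun j _ => hTint i j]
  refine Finset.sum_congr rfl fun j _ => ?_
  dsimp only [T]
  split_ifs <;> simp
end

section
/- Let n ≥ 3, let x₁, x₂ ∈ ℝⁿ with x₁ ≠ x₂, and let u : ℝⁿ → ℝ be smooth with compact support. Then ∫_{ℝⁿ} ‖∇u(x)‖² dx ≥ ((n−2)²/4) ∫_{ℝⁿ} ‖(x − x₁)/‖x − x₁‖² − (x − x₂)/‖x − x₂‖²‖² u²(x) dx. -/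
open MeasureTheory Filter Topology

/-- Completing the square with a vector field: the energy of `u` dominates the integral of
`(div F - ‖F‖²) u²`. -/
theorem integral_div_sub_norm_sq_mul_sq_le {n : ℕ}
    {F : EuclideanSpace ℝ (Fin n) → EuclideanSpace ℝ (Fin n)} (hF : ContDiff ℝ 1 F)
    {u : EuclideanSpace ℝ (Fin n) → ℝ} (hu : ContDiff ℝ 1 u) (hsupp : HasCompactSupport u) :
    ∫ x, ((∑ i, fderiv ℝ F x (EuclideanSpace.single i 1) i) - ‖F x‖ ^ 2) * u x ^ 2 ≤
      ∫ x, ‖gradient u x‖ ^ 2 := by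
  have hFc : Continuous F := hF.continuous
  have huc : Continuous u := hu.continuous
  have hF' : ∀ v, Continuous fun x => fderiv ℝ F x v := fun v =>
    (hF.continuous_fderiv one_ne_zero).clm_apply continuous_const
  have hu' : ∀ v, Continuous fun x => fderiv ℝ u x v := fun v =>
    (hu.continuous_fderiv one_ne_zero).clm_apply continuous_const
  have hud : ∀ x, DifferentiableAt ℝ u x := fun x => hu.differentiable one_ne_zero x
  have hcoord : ∀ x i, HasFDerivAt (fun y => F y i)
      ((EuclideanSpace.proj i : EuclideanSpace ℝ (Fin n) →L[ℝ] ℝ) ∘L fderiv ℝ F x) x := fun x i =>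
    (EuclideanSpace.proj i : EuclideanSpace ℝ (Fin n) →L[ℝ] ℝ).hasFDerivAt.comp x
      (hF.differentiable one_ne_zero x).hasFDerivAt
  have hcoord' : ∀ x v i, fderiv ℝ (fun y => F y i) x v = fderiv ℝ F x v i := fun x v i => by
    rw [(hcoord x i).fderiv]; rfl
  have hsq : ∀ x v, fderiv ℝ (fun y => u y ^ 2) x v = 2 * u x * fderiv ℝ u x v := fun x v => by
    rw [((hud x).hasFDerivAt.pow 2).fderiv]
    simp
  have hint : ∀ g : EuclideanSpace ℝ (Fin n) → ℝ, Continuous g →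
      Integrable (fun x => g x * u x) := fun g hg =>
    (hg.mul huc).integrable_of_hasCompactSupport hsupp.mul_left
  have hint₁ : ∀ i, Integrable fun x =>
      fderiv ℝ F x (EuclideanSpace.single i 1) i * u x ^ 2 := fun i => by
    have := hF' (EuclideanSpace.single i 1)
    refine (hint (fun x => fderiv ℝ F x (EuclideanSpace.single i 1) i * u x)
      (by fun_prop)).congr (.of_forall fun x => ?_)
    ring
  have hint₂ : ∀ i, Integrable fun x =>
      F x i * (2 * u x * fderiv ℝ u x (EuclideanSpace.single i 1)) := fun i => by
    have := hu' (EuclideanSpace.single i 1)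
    refine (hint (fun x => F x i * 2 * fderiv ℝ u x (EuclideanSpace.single i 1))
      (by fun_prop)).congr (.of_forall fun x => ?_)
    ring
  have hint₃ : ∀ i, Integrable fun x => F x i * u x ^ 2 := fun i =>
    (hint (fun x => F x i * u x) (by fun_prop)).congr (.of_forall fun x => by ring)
  have hparts : ∀ i, ∫ x, F x i * (2 * u x * fderiv ℝ u x (EuclideanSpace.single i 1)) =
      -∫ x, fderiv ℝ F x (EuclideanSpace.single i 1) i * u x ^ 2 := fun i => by
    have h := integral_mul_fderiv_eq_neg_fderiv_mul_of_integrable (μ := volume)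
      (f := fun x => F x i) (g := fun x => u x ^ 2) (v := EuclideanSpace.single i (1 : ℝ))
      (by simpa only [hcoord'] using hint₁ i) (by simpa only [hsq] using hint₂ i) (hint₃ i)
      (fun x _ => (hcoord x i).differentiableAt) (fun x _ => (hud x).pow 2)
    simpa only [hcoord', hsq] using h
  have hgrad : ∀ x i, gradient u x i = fderiv ℝ u x (EuclideanSpace.single i 1) := fun x i => by
    have : inner ℝ (gradient u x) (EuclideanSpace.single i 1) =
        fderiv ℝ u x (EuclideanSpace.single i 1) := by simp [gradient]
    rw [← this, EuclideanSpace.inner_single_right]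
    simp
  have hgradc : Continuous (gradient u) :=
    (InnerProductSpace.toDual ℝ _).symm.continuous.comp (hu.continuous_fderiv one_ne_zero)
  have hgradi : Integrable fun x => ‖gradient u x‖ ^ 2 := by
    refine (by fun_prop : Continuous fun x => ‖gradient u x‖ ^ 2).integrable_of_hasCompactSupport
      ((hsupp.fderiv ℝ).comp_left (g := fun L => ‖(InnerProductSpace.toDual ℝ _).symm L‖ ^ 2) ?_)
    simp
  have hpot : Integrable fun x =>
      ((∑ i, fderiv ℝ F x (EuclideanSpace.single i 1) i) - ‖F x‖ ^ 2) * u x ^ 2 := by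
    refine (hint (fun x =>
      ((∑ i, fderiv ℝ F x (EuclideanSpace.single i 1) i) - ‖F x‖ ^ 2) * u x) ?_).congr
      (.of_forall fun x => by ring)
    fun_prop
  have hpt : ∀ x, ‖gradient u x + u x • F x‖ ^ 2 = (‖gradient u x‖ ^ 2 -
      ((∑ i, fderiv ℝ F x (EuclideanSpace.single i 1) i) - ‖F x‖ ^ 2) * u x ^ 2) +
      ∑ i, (F x i * (2 * u x * fderiv ℝ u x (EuclideanSpace.single i 1)) +
        fderiv ℝ F x (EuclideanSpace.single i 1) i * u x ^ 2) := fun x => by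
    simp only [EuclideanSpace.real_norm_sq_eq, sub_mul, Finset.sum_mul, ← Finset.sum_sub_distrib,
      ← Finset.sum_add_distrib]
    refine Finset.sum_congr rfl fun i _ => ?_
    simp only [PiLp.add_apply, PiLp.smul_apply, smul_eq_mul, hgrad]
    ring
  have hnonneg : 0 ≤ ∫ x, ‖gradient u x + u x • F x‖ ^ 2 := integral_nonneg fun x => by positivity
  have hint₄ : ∀ i, Integrable fun x =>
      F x i * (2 * u x * fderiv ℝ u x (EuclideanSpace.single i 1)) +
        fderiv ℝ F x (EuclideanSpace.single i 1) i * u x ^ 2 := fun i => (hint₂ i).add (hint₁ i)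
  have hdiff : Integrable fun x => ‖gradient u x‖ ^ 2 -
      ((∑ i, fderiv ℝ F x (EuclideanSpace.single i 1) i) - ‖F x‖ ^ 2) * u x ^ 2 :=
    hgradi.sub hpot
  have hdiv : ∫ x, ∑ i, (F x i * (2 * u x * fderiv ℝ u x (EuclideanSpace.single i 1)) +
      fderiv ℝ F x (EuclideanSpace.single i 1) i * u x ^ 2) = 0 := by
    rw [integral_finsetSum _ fun i _ => hint₄ i]
    refine Finset.sum_eq_zero fun i _ => ?_
    rw [integral_add (hint₂ i) (hint₁ i), hparts, neg_add_cancel]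
  rw [integral_congr_ae (.of_forall hpt), integral_add hdiff
    (integrable_finsetSum _ fun i _ => hint₄ i), hdiv, add_zero,
    integral_sub hgradi hpot] at hnonneg
  linarith

/-- Fatou's lemma for Bochner integrals of nonnegative functions with bounded integrals. -/
theorem integral_le_of_tendsto_of_forall_integral_le {α : Type*} [MeasurableSpace α]
    {μ : Measure α} {f : ℕ → α → ℝ} {g : α → ℝ} {C : ℝ} (hf : ∀ k, Integrable (f k) μ)
    (hf₀ : ∀ k x, 0 ≤ f k x) (hC : ∀ k, ∫ x, f k x ∂μ ≤ C)
    (hlim : ∀ x, Tendsto (fun k => f k x) atTop (𝓝 (g x))) : ∫ x, g x ∂μ ≤ C := by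
  have hg₀ : ∀ x, 0 ≤ g x := fun x => ge_of_tendsto' (hlim x) fun k => hf₀ k x
  have hgm : AEStronglyMeasurable g μ :=
    aestronglyMeasurable_of_tendsto_ae atTop (fun k => (hf k).aestronglyMeasurable)
      (.of_forall hlim)
  have hC₀ : 0 ≤ C := (integral_nonneg (hf₀ 0)).trans (hC 0)
  rw [integral_eq_lintegral_of_nonneg_ae (.of_forall hg₀) hgm]
  refine ENNReal.toReal_le_of_le_ofReal hC₀ ?_
  calc ∫⁻ x, ENNReal.ofReal (g x) ∂μ
      = ∫⁻ x, liminf (fun k => ENNReal.ofReal (f k x)) atTop ∂μ :=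
        lintegral_congr fun x => (ENNReal.tendsto_ofReal (hlim x)).liminf_eq.symm
    _ ≤ liminf (fun k => ∫⁻ x, ENNReal.ofReal (f k x) ∂μ) atTop :=
        lintegral_liminf_le' fun k => (hf k).aestronglyMeasurable.aemeasurable.ennreal_ofReal
    _ ≤ ENNReal.ofReal C := by
        refine liminf_le_of_frequently_le' (Frequently.of_forall fun k => ?_)
        rw [← ofReal_integral_eq_lintegral_ofReal (hf k) (.of_forall (hf₀ k))]
        exact ENNReal.ofReal_le_ofReal (hC k)

/-- The regularization `(x - p) / (‖x - p‖² + ε)` of the field `(x - p) / ‖x - p‖²`. -/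
noncomputable def regularizedPole {n : ℕ} (p : EuclideanSpace ℝ (Fin n)) (ε : ℝ)
    (x : EuclideanSpace ℝ (Fin n)) : EuclideanSpace ℝ (Fin n) :=
  (‖x - p‖ ^ 2 + ε)⁻¹ • (x - p)

theorem contDiff_regularizedPole {n : ℕ} (p : EuclideanSpace ℝ (Fin n)) {ε : ℝ} (hε : 0 < ε) :
    ContDiff ℝ 1 (regularizedPole p ε) := by
  have hsub : ContDiff ℝ 1 fun x : EuclideanSpace ℝ (Fin n) => x - p := by fun_prop
  exact (((hsub.norm_sq ℝ).add contDiff_const).inv fun x => by positivity).smul hsub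

theorem div_regularizedPole {n : ℕ} (p : EuclideanSpace ℝ (Fin n)) {ε : ℝ} (hε : 0 < ε)
    (x : EuclideanSpace ℝ (Fin n)) :
    ∑ i, fderiv ℝ (regularizedPole p ε) x (EuclideanSpace.single i 1) i =
      n / (‖x - p‖ ^ 2 + ε) - 2 * ‖x - p‖ ^ 2 / (‖x - p‖ ^ 2 + ε) ^ 2 := by
  have hne : ‖x - p‖ ^ 2 + ε ≠ 0 := by positivity
  have hsub : HasFDerivAt (fun y => y - p) (ContinuousLinearMap.id ℝ _) x :=
    (hasFDerivAt_id x).sub_const p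
  have h := ((hasDerivAt_inv hne).comp_hasFDerivAt x (hsub.norm_sq.add_const ε)).smul hsub
  have hi : ∀ i, fderiv ℝ (regularizedPole p ε) x (EuclideanSpace.single i 1) i =
      (‖x - p‖ ^ 2 + ε)⁻¹ - 2 * (x - p) i ^ 2 / (‖x - p‖ ^ 2 + ε) ^ 2 := fun i => by
    have h' : fderiv ℝ (regularizedPole p ε) x = _ := h.fderiv
    rw [h']
    simp [EuclideanSpace.inner_single_right]
    ring
  simp only [hi, Finset.sum_sub_distrib, ← Finset.sum_div, ← Finset.mul_sum,
    ← EuclideanSpace.real_norm_sq_eq]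
  simp [div_eq_mul_inv]

theorem le_div_regularizedPole {n : ℕ} (hn : 2 ≤ n) (p : EuclideanSpace ℝ (Fin n)) {ε : ℝ}
    (hε : 0 < ε) (x : EuclideanSpace ℝ (Fin n)) :
    ((n : ℝ) - 2) * ‖regularizedPole p ε x‖ ^ 2 ≤
      ∑ i, fderiv ℝ (regularizedPole p ε) x (EuclideanSpace.single i 1) i := by
  have hpos : 0 < ‖x - p‖ ^ 2 + ε := by positivity
  have hn' : (2 : ℝ) ≤ n := by exact_mod_cast hn
  rw [div_regularizedPole p hε, regularizedPole, norm_smul, mul_pow, norm_inv, inv_pow,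
    Real.norm_of_nonneg hpos.le, ← sub_nonneg]
  have : (n : ℝ) / (‖x - p‖ ^ 2 + ε) - 2 * ‖x - p‖ ^ 2 / (‖x - p‖ ^ 2 + ε) ^ 2 -
      ((n : ℝ) - 2) * (((‖x - p‖ ^ 2 + ε) ^ 2)⁻¹ * ‖x - p‖ ^ 2) =
      n * ε / (‖x - p‖ ^ 2 + ε) ^ 2 := by
    field_simp
    ring
  rw [this]
  positivity

theorem tendsto_regularizedPole {n : ℕ} (p x : EuclideanSpace ℝ (Fin n)) {ε : ℕ → ℝ}
    (hε : Tendsto ε atTop (𝓝 0)) :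
    Tendsto (fun k => regularizedPole p (ε k) x) atTop (𝓝 ((‖x - p‖ ^ 2)⁻¹ • (x - p))) := by
  rcases eq_or_ne x p with rfl | hx
  · simp [regularizedPole]
  · have hne : ‖x - p‖ ^ 2 ≠ 0 := by simpa [sub_eq_zero] using hx
    have h := (hε.const_add (‖x - p‖ ^ 2)).inv₀ (by simpa using hne)
    rw [add_zero] at h
    exact h.smul_const _

/-- The bipolar Hardy inequality for the regularized fields. -/
theorem integral_regularizedPole_sub_le {n : ℕ} (hn : 2 ≤ n) (p₁ p₂ : EuclideanSpace ℝ (Fin n))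
    {u : EuclideanSpace ℝ (Fin n) → ℝ} (hu : ContDiff ℝ 1 u) (hsupp : HasCompactSupport u)
    {ε : ℝ} (hε : 0 < ε) :
    ((n : ℝ) - 2) ^ 2 / 4 *
        ∫ x, ‖regularizedPole p₁ ε x - regularizedPole p₂ ε x‖ ^ 2 * u x ^ 2 ≤
      ∫ x, ‖gradient u x‖ ^ 2 := by
  have hC₁ := contDiff_regularizedPole p₁ hε
  have hC₂ := contDiff_regularizedPole p₂ hε
  have hn' : (0 : ℝ) ≤ ((n : ℝ) - 2) / 2 := by
    have : (2 : ℝ) ≤ n := by exact_mod_cast hn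
    linarith
  set F : EuclideanSpace ℝ (Fin n) → EuclideanSpace ℝ (Fin n) :=
    fun x => (((n : ℝ) - 2) / 2) • (regularizedPole p₁ ε x + regularizedPole p₂ ε x) with hFdef
  have hF : ContDiff ℝ 1 F := (hC₁.add hC₂).const_smul _
  have hdiv : ∀ x, ∑ i, fderiv ℝ F x (EuclideanSpace.single i 1) i = ((n : ℝ) - 2) / 2 *
      ((∑ i, fderiv ℝ (regularizedPole p₁ ε) x (EuclideanSpace.single i 1) i) +
        ∑ i, fderiv ℝ (regularizedPole p₂ ε) x (EuclideanSpace.single i 1) i) := fun x => by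
    have h : fderiv ℝ F x = _ := (((hC₁.differentiable one_ne_zero x).hasFDerivAt.add
      (hC₂.differentiable one_ne_zero x).hasFDerivAt).const_smul (((n : ℝ) - 2) / 2)).fderiv
    rw [h, ← Finset.sum_add_distrib, Finset.mul_sum]
    simp [mul_add]
  have hsq : HasCompactSupport fun x => u x ^ 2 :=
    hsupp.comp_left (g := fun t : ℝ => t ^ 2) (by simp)
  have hc₁ := hC₁.continuous
  have hc₂ := hC₂.continuous
  have huc := hu.continuous
  have hF' : ∀ v, Continuous fun x => fderiv ℝ F x v := fun v =>
    (hF.continuous_fderiv one_ne_zero).clm_apply continuous_const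
  have hFc := hF.continuous
  refine le_trans ?_ (integral_div_sub_norm_sq_mul_sq_le hF hu hsupp)
  rw [← integral_const_mul]
  refine integral_mono ?_ ?_ fun x => ?_
  · refine Integrable.const_mul ?_ _
    exact (by fun_prop : Continuous fun x => ‖regularizedPole p₁ ε x - regularizedPole p₂ ε x‖ ^ 2
      * u x ^ 2).integrable_of_hasCompactSupport hsq.mul_left
  · exact (by fun_prop : Continuous fun x =>
      ((∑ i, fderiv ℝ F x (EuclideanSpace.single i 1) i) - ‖F x‖ ^ 2)
      * u x ^ 2).integrable_of_hasCompactSupport hsq.mul_left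
  · have h₁ := le_div_regularizedPole hn p₁ hε x
    have h₂ := le_div_regularizedPole hn p₂ hε x
    have hpar := parallelogram_law_with_norm ℝ (regularizedPole p₁ ε x) (regularizedPole p₂ ε x)
    have hnorm : ‖F x‖ ^ 2 = (((n : ℝ) - 2) / 2) ^ 2 *
        ‖regularizedPole p₁ ε x + regularizedPole p₂ ε x‖ ^ 2 := by
      rw [hFdef, norm_smul, mul_pow, Real.norm_of_nonneg hn']
    simp only [← mul_assoc]
    refine mul_le_mul_of_nonneg_right ?_ (sq_nonneg _)
    rw [hdiv, hnorm]
    have h := mul_le_mul_of_nonneg_left (add_le_add h₁ h₂) hn'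
    linear_combination h + (((n : ℝ) - 2) / 2) ^ 2 * hpar

theorem euclidean_bipolar_hardy
    (n : ℕ) (hn : 3 ≤ n)
    (p₁ p₂ : EuclideanSpace ℝ (Fin n)) (hp : p₁ ≠ p₂)
    (u : EuclideanSpace ℝ (Fin n) → ℝ)
    (hu : ContDiff ℝ (⊤ : ℕ∞) u) (hsupp : HasCompactSupport u) :
    ∫ x : EuclideanSpace ℝ (Fin n), ‖gradient u x‖ ^ 2 ≥
      (((n : ℝ) - 2) ^ 2 / 4) *
        ∫ x : EuclideanSpace ℝ (Fin n),
          ‖(‖x - p₁‖ ^ 2)⁻¹ • (x - p₁) - (‖x - p₂‖ ^ 2)⁻¹ • (x - p₂)‖ ^ 2 * u x ^ 2 := by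
  have hu₁ : ContDiff ℝ 1 u := hu.of_le (by exact_mod_cast le_top)
  have huc := hu₁.continuous
  have hpos : ∀ k : ℕ, (0 : ℝ) < 1 / ((k : ℝ) + 1) := fun k => Nat.one_div_pos_of_nat
  rw [ge_iff_le, ← integral_const_mul]
  refine integral_le_of_tendsto_of_forall_integral_le
    (f := fun k x => ((n : ℝ) - 2) ^ 2 / 4 *
      (‖regularizedPole p₁ (1 / ((k : ℝ) + 1)) x - regularizedPole p₂ (1 / ((k : ℝ) + 1)) x‖ ^ 2 *
        u x ^ 2)) (fun k => ?_) (fun k x => by positivity) (fun k => ?_) fun x => ?_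
  · have hc₁ := (contDiff_regularizedPole p₁ (hpos k)).continuous
    have hc₂ := (contDiff_regularizedPole p₂ (hpos k)).continuous
    refine Integrable.const_mul (Continuous.integrable_of_hasCompactSupport (by fun_prop) ?_) _
    exact (hsupp.comp_left (g := fun t : ℝ => t ^ 2) (by simp)).mul_left
  · rw [integral_const_mul]
    exact integral_regularizedPole_sub_le (by omega) p₁ p₂ hu₁ hsupp (hpos k)
  · have hε := tendsto_one_div_add_atTop_nhds_zero_nat (𝕜 := ℝ)
    exact ((((tendsto_regularizedPole p₁ x hε).sub
      (tendsto_regularizedPole p₂ x hε)).norm.pow 2).mul_const _).const_mul _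
end
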